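/- Let (Γ,S) be an infinite marked group. Then (a) there is no Baire measurable 2-coloring of the shift graph of (Γ,S), and (b) for every p with 0 < p < 1, letting μ_p be the Bernoulli product measure on 2^Γ (which concentrates on F(2^Γ)), there is no μ_p-measurable 2-coloring of the shift graph of (Γ,S). In particular the Baire measurable and measure chromatic numbers of the shift graph are both greater than 2. -/

import Mathlib

open Multiplicative

section Defs

variable {G : Type*} [Group G]

/-- The left shift action of `g : G` on `x : G → Bool` (`2^G` with `2 = Bool`):
`(g · x)(h) = x (g⁻¹ h)`. -/
def shiftMap (g : G) (x : G → Bool) : G → Bool := fun h => x (g⁻¹ * h)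

/-- The free part `F(2^G)` of the left shift action. -/
def FreePart (G : Type*) [Group G] : Set (G → Bool) :=
  {x | ∀ g : G, g ≠ 1 → shiftMap g x ≠ x}

/-- Adjacency in the shift graph of the marked group `(G, S)`: distinct `x, y ∈ F(2^G)`
are adjacent iff `y = s · x` for some `s ∈ S`. -/
def ShiftAdj (S : Set G) (x y : FreePart G) : Prop :=
  x ≠ y ∧ ∃ s ∈ S, (y : G → Bool) = shiftMap s (x : G → Bool)

/-- Adjacency in the Cayley graph of `(G, S)`: distinct `g, h` are adjacent iff
`h = s * g` for some `s ∈ S`. -/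
def CayleyAdj (S : Set G) (g h : G) : Prop :=
  g ≠ h ∧ ∃ s ∈ S, h = s * g

/-- `(G, S)` is a marked group: `S` is a finite symmetric generating set
not containing the identity. -/
def IsMarkedGroup (S : Set G) : Prop :=
  S.Finite ∧ (∀ s ∈ S, s⁻¹ ∈ S) ∧ (1 : G) ∉ S ∧ Subgroup.closure S = ⊤

end Defs

/-- A graph (given by its adjacency relation) has an `n`-coloring. -/
def HasColoring {X : Type*} (Adj : X → X → Prop) (n : ℕ) : Prop :=
  ∃ c : X → Fin n, ∀ x y, Adj x y → c x ≠ c y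

/-- The chromatic number: the least `n` admitting an `n`-coloring. -/
noncomputable def chromatic {X : Type*} (Adj : X → X → Prop) : ℕ :=
  sInf {n | HasColoring Adj n}

/-- A graph on a measurable space has a Borel `n`-coloring. -/
def HasBorelColoring {X : Type*} [MeasurableSpace X] (Adj : X → X → Prop) (n : ℕ) : Prop :=
  ∃ c : X → Fin n, Measurable c ∧ ∀ x y, Adj x y → c x ≠ c y

/-- The Borel chromatic number: the least `n` admitting a Borel `n`-coloring. -/
noncomputable def borelChromatic {X : Type*} [MeasurableSpace X] (Adj : X → X → Prop) : ℕ :=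
  sInf {n | HasBorelColoring Adj n}
open MeasureTheory

/-- `μ` is the Bernoulli product measure `μ_p` on `2^G`: the product over `G` of the
measure on `2 = {0,1} = Bool` giving `{0}` measure `p`, characterized by its values on
cylinder sets. -/
def IsBernoulli {G : Type*} [Group G] (p : ℝ) (μ : Measure (G → Bool)) : Prop :=
  IsProbabilityMeasure μ ∧
  ∀ s : Finset G, ∀ f : G → Bool,
    μ {x | ∀ h ∈ s, x h = f h} =
      ∏ h ∈ s, (if f h = false then ENNReal.ofReal p else ENNReal.ofReal (1 - p))

section Helpers

set_option linter.unusedSectionVars false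

variable {G : Type*} [Group G]

lemma shiftMap_one (x : G → Bool) : shiftMap 1 x = x := by
  funext k; simp [shiftMap]

lemma shiftMap_mul (g h : G) (x : G → Bool) :
    shiftMap (g * h) x = shiftMap g (shiftMap h x) := by
  funext k; simp [shiftMap, mul_assoc]

lemma shiftMap_mem_freePart (g : G) {x : G → Bool} (hx : x ∈ FreePart G) :
    shiftMap g x ∈ FreePart G := by
  intro k hk h
  apply hx (g⁻¹ * k * g)
  · intro h1
    apply hk
    have : k = g * (g⁻¹ * k * g) * g⁻¹ := by group
    rw [this, h1]; group
  · rw [shiftMap_mul, shiftMap_mul, h, ← shiftMap_mul]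
    simp [shiftMap_one]

/-- The shift restricted to the free part. -/
def fshift (g : G) (x : FreePart G) : FreePart G :=
  ⟨shiftMap g x, shiftMap_mem_freePart g x.2⟩

lemma fshift_one (x : FreePart G) : fshift 1 x = x := Subtype.ext (shiftMap_one _)

lemma fshift_mul (g h : G) (x : FreePart G) : fshift (g * h) x = fshift g (fshift h x) :=
  Subtype.ext (shiftMap_mul _ _ _)

lemma fshift_adj {S : Set G} (hS : IsMarkedGroup S) {s : G} (hs : s ∈ S) (x : FreePart G) :
    ShiftAdj S x (fshift s x) := by
  refine ⟨fun h => ?_, s, hs, rfl⟩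
  refine x.2 s (fun h1 => hS.2.2.1 (h1 ▸ hs)) ?_
  exact (congrArg Subtype.val h).symm

lemma fin2_cases {a b c : Fin 2} (h1 : a ≠ b) (h2 : b ≠ c) : a = c := by
  omega

lemma parity {S : Set G} (hS : IsMarkedGroup S) (c : FreePart G → Fin 2)
    (hc : ∀ x y, ShiftAdj S x y → c x ≠ c y) (g : G) :
    (∀ x, c (fshift g x) = c x) ∨ (∀ x, c (fshift g x) ≠ c x) := by
  have hg : g ∈ Subgroup.closure S := by rw [hS.2.2.2]; trivial
  induction hg using Subgroup.closure_induction with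
  | mem s hs => exact Or.inr fun x => (hc _ _ (fshift_adj hS hs x)).symm
  | one => exact Or.inl fun x => by rw [fshift_one]
  | mul a b _ _ ha hb =>
    simp only [fshift_mul]
    rcases ha with ha | ha <;> rcases hb with hb | hb
    · exact Or.inl fun x => by rw [ha, hb]
    · exact Or.inr fun x => by rw [ha]; exact hb x
    · exact Or.inr fun x => by rw [← hb x]; exact ha _
    · exact Or.inl fun x => fin2_cases (ha _) (hb x)
  | inv a _ ha =>
    rcases ha with ha | ha
    · exact Or.inl fun x => by
        rw [← ha (fshift a⁻¹ x), ← fshift_mul]; simp [fshift_one]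
    · exact Or.inr fun x => by
        have := ha (fshift a⁻¹ x)
        rw [← fshift_mul] at this
        simp only [mul_inv_cancel, fshift_one] at this
        exact this.symm

lemma even_infinite [Infinite G] {S : Set G} (hS : IsMarkedGroup S) (c : FreePart G → Fin 2)
    (hc : ∀ x y, ShiftAdj S x y → c x ≠ c y) :
    {g : G | ∀ x, c (fshift g x) = c x}.Infinite := by
  set H := {g : G | ∀ x, c (fshift g x) = c x} with hH
  intro hfin
  have hinf : Hᶜ.Infinite := hfin.infinite_compl
  obtain ⟨g0, hg0⟩ := hinf.nonempty
  have key : ∀ g ∈ Hᶜ, ∀ x, c (fshift g x) ≠ c x := fun g hg =>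
    (parity hS c hc g).resolve_left hg
  have hsub : (fun g => g * g0) '' Hᶜ ⊆ H := by
    rintro _ ⟨g, hg, rfl⟩ x
    rw [fshift_mul]
    exact fin2_cases (key g hg _) (key g0 hg0 x)
  exact (hinf.image (mul_left_injective g0).injOn) (hfin.subset hsub)

lemma exists_avoid {H : Set G} (hH : H.Infinite) (T : Finset G) :
    ∃ h ∈ H, ∀ a ∈ T, ∀ b ∈ T, h * a ≠ b := by
  classical
  obtain ⟨h, hh, hn⟩ := hH.exists_notMem_finset (Finset.image₂ (fun a b => b * a⁻¹) T T)
  refine ⟨h, hh, fun a ha b hb e => hn ?_⟩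
  exact Finset.mem_image₂.2 ⟨a, ha, b, hb, by rw [← e]; group⟩

lemma markedGroup_nonempty [Infinite G] {S : Set G} (hS : IsMarkedGroup S) : S.Nonempty := by
  rw [Set.nonempty_iff_ne_empty]
  rintro rfl
  have h := hS.2.2.2
  rw [Subgroup.closure_empty] at h
  have := Subgroup.subsingleton_iff.1 (subsingleton_of_bot_eq_top h)
  exact not_subsingleton G this

lemma markedGroup_countable {S : Set G} (hS : IsMarkedGroup S) : Countable G := by
  have : Countable S := hS.1.countable.to_subtype
  have : Countable (FreeGroup S) := Quot.mk_surjective.countable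
  have h : (FreeGroup.lift ((↑) : S → G)).range = ⊤ := by
    rw [FreeGroup.range_lift_eq_closure]; simpa using hS.2.2.2
  exact (MonoidHom.range_eq_top.1 h).countable

lemma open_cyl {V : Set (G → Bool)} (hV : IsOpen V) {x : G → Bool} (hx : x ∈ V) :
    ∃ T : Finset G, ∀ y : G → Bool, (∀ k ∈ T, y k = x k) → y ∈ V := by
  obtain ⟨T, u, hu, hsub⟩ := isOpen_pi_iff.1 hV x hx
  refine ⟨T, fun y hy => hsub fun k hk => ?_⟩
  rw [hy k hk]; exact (hu k hk).2

lemma continuous_shiftMap (g : G) : Continuous (shiftMap g) :=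
  continuous_pi fun k => continuous_apply (g⁻¹ * k)

lemma freePart_eq : FreePart G = ⋂ g ∈ {g : G | g ≠ 1}, {x | shiftMap g x ≠ x} := by
  ext x; simp [FreePart]

lemma isOpen_moved (g : G) : IsOpen {x : G → Bool | shiftMap g x ≠ x} :=
  isOpen_ne_fun (continuous_shiftMap g) continuous_id

lemma dense_moved [Infinite G] {g : G} (hg : g ≠ 1) :
    Dense {x : G → Bool | shiftMap g x ≠ x} := by
  classical
  rw [dense_iff_inter_open]
  rintro V hV ⟨x, hx⟩
  obtain ⟨T, hT⟩ := open_cyl hV hx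
  obtain ⟨k, hk⟩ := Infinite.exists_notMem_finset T
  refine ⟨Function.update x k (!(x (g⁻¹ * k))), hT _ fun j hj => ?_, fun h => ?_⟩
  · rw [Function.update_of_ne]; rintro rfl; exact hk hj
  · have := congrFun h k
    have hne : g⁻¹ * k ≠ k := by simpa using hg
    simp [shiftMap, Function.update_of_ne hne] at this

lemma isGδ_freePart [Countable G] : IsGδ (FreePart G) := by
  rw [freePart_eq]
  exact IsGδ.biInter_of_isOpen (Set.to_countable _) fun g _ => isOpen_moved g

lemma dense_freePart [Countable G] [Infinite G] : Dense (FreePart G) := by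
  rw [freePart_eq]
  exact dense_biInter_of_isOpen (fun g _ => isOpen_moved g) (Set.to_countable _)
    fun g hg => dense_moved hg

/-- The shift on the free part as a homeomorphism. -/
def fshiftHomeo (g : G) : FreePart G ≃ₜ FreePart G where
  toFun := fshift g
  invFun := fshift g⁻¹
  left_inv x := by rw [← fshift_mul]; simp [fshift_one]
  right_inv x := by rw [← fshift_mul]; simp [fshift_one]
  continuous_toFun := ((continuous_shiftMap g).comp continuous_subtype_val).subtype_mk _
  continuous_invFun := ((continuous_shiftMap g⁻¹).comp continuous_subtype_val).subtype_mk _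

lemma tendsto_fshift (g : G) :
    Filter.Tendsto (fshift g) (residual (FreePart G)) (residual (FreePart G)) :=
  tendsto_residual_of_isOpenMap (fshiftHomeo g).continuous (fshiftHomeo g).isOpenMap

theorem no_baire [Infinite G] {S : Set G} (hS : IsMarkedGroup S) (c : FreePart G → Fin 2)
    (hm : ∀ i : Fin 2, BaireMeasurableSet (c ⁻¹' {i}))
    (hc : ∀ x y, ShiftAdj S x y → c x ≠ c y) : False := by
  classical
  have : Countable G := markedGroup_countable hS
  have hB : BaireSpace (FreePart G) := isGδ_freePart.baireSpace_of_dense dense_freePart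
  have hne : Nonempty (FreePart G) := (dense_freePart (G := G)).nonempty.to_subtype
  obtain ⟨s, hs⟩ := markedGroup_nonempty hS
  choose U hUo hU using fun i => (hm i).residualEq_isOpen
  have hU' : ∀ i, ∀ᶠ x in residual (FreePart G), (c x = i ↔ x ∈ U i) := fun i =>
    Filter.eventuallyEq_set.1 (hU i)
  have hUne : ∀ i, (U i).Nonempty := by
    intro i
    by_contra h
    rw [Set.not_nonempty_iff_eq_empty] at h
    have h1 : ∀ᶠ x in residual (FreePart G), c x ≠ i := by
      filter_upwards [hU' i] with x hx
      rw [h] at hx; simpa using hx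
    obtain ⟨x, hx⟩ := (dense_of_mem_residual (h1.and ((tendsto_fshift s).eventually h1))).nonempty
    exact hc _ _ (fshift_adj hS hs x) (fin2_cases hx.1 (hx.2.symm))
  have hV : ∀ i, ∃ V : Set (G → Bool), IsOpen V ∧ Subtype.val ⁻¹' V = U i := fun i =>
    isOpen_induced_iff.1 (hUo i)
  choose V hVo hV using hV
  obtain ⟨x0, hx0⟩ := hUne 0
  obtain ⟨x1, hx1⟩ := hUne 1
  rw [← hV] at hx0 hx1
  obtain ⟨T0, hT0⟩ := open_cyl (hVo 0) hx0
  obtain ⟨T1, hT1⟩ := open_cyl (hVo 1) hx1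
  obtain ⟨h, hH, hav⟩ := exists_avoid (even_infinite hS c hc) (T0 ∪ T1)
  let y : G → Bool := fun k => if k ∈ T0 then x0.1 k else x1.1 (h * k)
  have hy0 : y ∈ V 0 := hT0 _ fun k hk => by simp [y, hk]
  have hy1 : shiftMap h y ∈ V 1 := hT1 _ fun k hk => by
    have : h⁻¹ * k ∉ T0 := fun hk0 =>
      hav (h⁻¹ * k) (Finset.mem_union_left _ hk0) k (Finset.mem_union_right _ hk) (by group)
    simp [shiftMap, y, this]
  obtain ⟨z, hz, hzF⟩ := dense_freePart.inter_open_nonempty (V 0 ∩ shiftMap h ⁻¹' V 1)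
    ((hVo 0).inter ((hVo 1).preimage (continuous_shiftMap h))) ⟨y, hy0, hy1⟩
  have hWo : IsOpen (U 0 ∩ fshift h ⁻¹' U 1) :=
    (hUo 0).inter ((hUo 1).preimage (fshiftHomeo h).continuous)
  have hWne : (U 0 ∩ fshift h ⁻¹' U 1).Nonempty := by
    refine ⟨⟨z, hzF⟩, ?_, ?_⟩
    · rw [← hV]; exact hz.1
    · rw [← hV]; exact hz.2
  obtain ⟨w, hw, hw'⟩ := (dense_of_mem_residual
    ((hU' 0).and ((tendsto_fshift h).eventually (hU' 1)))).inter_open_nonempty _ hWo hWne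
  have e0 := hw'.1.2 hw.1
  have e1 := hw'.2.2 hw.2
  rw [hH w, e0] at e1
  exact absurd e1 (by decide)

open scoped symmDiff

lemma bern_unique {p : ℝ} {μ ν : Measure (G → Bool)} (hμ : IsBernoulli p μ)
    (hν : IsBernoulli p ν) : μ = ν := by
  classical
  have := hμ.1
  have := hν.1
  have key : ∀ I : Finset G, μ.map I.restrict = ν.map I.restrict := by
    intro I
    apply Measure.ext_of_singleton
    intro a
    have hI : Measurable (I.restrict : (G → Bool) → (I → Bool)) := Finset.measurable_restrict I
    rw [Measure.map_apply hI (measurableSet_singleton _),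
      Measure.map_apply hI (measurableSet_singleton _)]
    have : (I.restrict : (G → Bool) → (I → Bool)) ⁻¹' {a} =
        {x | ∀ h ∈ I, x h = (fun k => if hk : k ∈ I then a ⟨k, hk⟩ else false) h} := by
      ext x
      simp only [Set.mem_preimage, Set.mem_singleton_iff, Set.mem_ofPred_eq, funext_iff]
      constructor
      · intro h k hk
        simpa [hk] using h ⟨k, hk⟩
      · rintro h ⟨k, hk⟩
        simpa [hk] using h k hk
    rw [this, hμ.2, hν.2]
  have h2 : ∀ I : Finset G, IsFiniteMeasure (ν.map (I.restrict : (G → Bool) → (I → Bool))) :=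
    fun I => inferInstance
  exact IsProjectiveLimit.unique (P := fun I : Finset G => ν.map I.restrict)
    (fun I => key I) (fun I => rfl)

/-- The Bernoulli measure on `Bool`. -/
noncomputable def bernBool (p : ℝ) : Measure Bool :=
  ENNReal.ofReal p • Measure.dirac false + ENNReal.ofReal (1 - p) • Measure.dirac true

lemma bernBool_prob {p : ℝ} (hp : p ∈ Set.Ioo (0 : ℝ) 1) : IsProbabilityMeasure (bernBool p) := by
  constructor
  simp only [bernBool, Measure.coe_add, Measure.coe_smul, Pi.add_apply, Pi.smul_apply,
    measure_univ, smul_eq_mul, mul_one]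
  rw [← ENNReal.ofReal_add hp.1.le (by linarith [hp.2])]
  simp

lemma bern_eq_infinitePi {p : ℝ} (hp : p ∈ Set.Ioo (0 : ℝ) 1) {μ : Measure (G → Bool)}
    (hμ : IsBernoulli p μ) : ∃ ν : Measure Bool, ∃ _ : IsProbabilityMeasure ν,
      μ = Measure.infinitePi (fun _ : G => ν) := by
  have := bernBool_prob hp
  refine ⟨bernBool p, this, bern_unique hμ ⟨inferInstance, fun s f => ?_⟩⟩
  have : {x : G → Bool | ∀ h ∈ s, x h = f h} = Set.pi s (fun h => {f h}) := by
    ext x; simp [Set.mem_pi]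
  rw [this, Measure.infinitePi_pi _ (fun _ _ => measurableSet_singleton _)]
  refine Finset.prod_congr rfl fun h _ => ?_
  cases f h <;> simp [bernBool]

lemma bern_indep {p : ℝ} (hp : p ∈ Set.Ioo (0 : ℝ) 1) {μ : Measure (G → Bool)}
    (hμ : IsBernoulli p μ) (I J : Finset G) (hIJ : Disjoint I J) (A : Set (I → Bool))
    (B : Set (J → Bool)) :
    μ.real (cylinder I A ∩ cylinder J B) = μ.real (cylinder I A) * μ.real (cylinder J B) := by
  obtain ⟨ν, hν, rfl⟩ := bern_eq_infinitePi hp hμ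
  have h := (ProbabilityTheory.iIndepFun_infinitePi (P := fun _ : G => ν)
    (X := fun _ b => b) (fun _ => measurable_id)).indepFun_finset I J hIJ
      (fun i => measurable_pi_apply i)
  have := h.measure_inter_preimage_eq_mul A B (Set.toFinite A).measurableSet
    (Set.toFinite B).measurableSet
  rw [measureReal_def, measureReal_def, measureReal_def, ← ENNReal.toReal_mul]
  exact congrArg ENNReal.toReal this

lemma measurable_shiftMap (g : G) : Measurable (shiftMap g) :=
  measurable_pi_lambda _ fun k => measurable_pi_apply (g⁻¹ * k)

lemma bern_invariant {p : ℝ} {μ : Measure (G → Bool)}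
    (hμ : IsBernoulli p μ) (g : G) : MeasurePreserving (shiftMap g) μ μ := by
  classical
  refine ⟨measurable_shiftMap g, bern_unique ⟨?_, fun s f => ?_⟩ hμ⟩
  · have := hμ.1
    exact Measure.isProbabilityMeasure_map (measurable_shiftMap g).aemeasurable
  · have hm : MeasurableSet {x : G → Bool | ∀ h ∈ s, x h = f h} := by
      have : {x : G → Bool | ∀ h ∈ s, x h = f h} = Set.pi s (fun h => {f h}) := by
        ext x; simp [Set.mem_pi]
      rw [this]
      exact MeasurableSet.pi s.countable_toSet fun _ _ => measurableSet_singleton _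
    rw [Measure.map_apply (measurable_shiftMap g) hm]
    have : shiftMap g ⁻¹' {x : G → Bool | ∀ h ∈ s, x h = f h} =
        {x | ∀ h ∈ s.image (fun k => g⁻¹ * k), x h = f (g * h)} := by
      ext x
      constructor
      · intro hx k hk
        obtain ⟨j, hj, rfl⟩ := Finset.mem_image.1 hk
        simpa [shiftMap] using hx j hj
      · intro hx k hk
        simpa [shiftMap] using hx _ (Finset.mem_image_of_mem _ hk)
    rw [this, hμ.2 _ (fun h => f (g * h)), Finset.prod_image (by intro a _ b _ h; simpa using h)]
    simp

lemma bern_approx (μ : Measure (G → Bool)) [IsProbabilityMeasure μ]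
    {A : Set (G → Bool)} (hA : MeasurableSet A) {ε : ℝ} (hε : 0 < ε) :
    ∃ (T : Finset G) (B : Set (T → Bool)), μ.real (A ∆ cylinder T B) < ε := by
  obtain ⟨t, ht, h⟩ := (Measure.MeasureDense.of_generateFrom_isSetAlgebra_finite (μ := μ)
    (isSetAlgebra_measurableCylinders (α := fun _ : G => Bool))
    generateFrom_measurableCylinders.symm).approx A hA (measure_ne_top _ _) ε hε
  obtain ⟨T, B, _, rfl⟩ := (mem_measurableCylinders _).1 ht
  exact ⟨T, B, (ENNReal.lt_ofReal_iff_toReal_lt (measure_ne_top _ _)).1 h⟩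

lemma real_le_add_symmDiff (μ : Measure (G → Bool)) [IsProbabilityMeasure μ]
    (A C : Set (G → Bool)) : μ.real A ≤ μ.real C + μ.real (A ∆ C) := by
  refine (measureReal_mono (s₂ := C ∪ A ∆ C) ?_).trans (measureReal_union_le _ _)
  intro x hx
  by_cases h : x ∈ C
  · exact Or.inl h
  · exact Or.inr (Or.inl ⟨hx, h⟩)

lemma bern_fixed_null [Infinite G] [Countable G] {p : ℝ} (hp : p ∈ Set.Ioo (0 : ℝ) 1)
    {μ : Measure (G → Bool)} (hμ : IsBernoulli p μ) {g : G} (hg : g ≠ 1) :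
    μ {x | shiftMap g x = x} = 0 := by
  classical
  have := hμ.1
  set E := {x : G → Bool | shiftMap g x = x} with hE
  have hEm : MeasurableSet E := by
    have : E = ⋂ k : G, {x | x (g⁻¹ * k) = x k} := by
      ext x; simp [hE, funext_iff, shiftMap]
    rw [this]
    exact MeasurableSet.iInter fun k =>
      measurableSet_eq_fun (measurable_pi_apply _) (measurable_pi_apply _)
  suffices h : μ.real E = 0 by
    rwa [measureReal_def, ENNReal.toReal_eq_zero_iff, or_iff_left (measure_ne_top _ _)] at h
  by_contra hne
  have hpos : 0 < μ.real E := lt_of_le_of_ne measureReal_nonneg (Ne.symm hne)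
  have hq : 0 < p * (1 - p) := mul_pos hp.1 (by linarith [hp.2])
  obtain ⟨T, B, hTB⟩ := bern_approx μ hEm (ε := p * (1 - p) * μ.real E / 4) (by positivity)
  obtain ⟨k, hk⟩ := Infinite.exists_notMem_finset (T ∪ T.image (fun j => g * j))
  rw [Finset.mem_union, not_or] at hk
  have hk2 : g⁻¹ * k ∉ T := fun h => hk.2 (Finset.mem_image.2 ⟨_, h, by group⟩)
  have hkne : g⁻¹ * k ≠ k := by simpa using hg
  let J : Finset G := {k, g⁻¹ * k}
  have hkJ : k ∈ J := by simp [J]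
  have hkJ2 : g⁻¹ * k ∈ J := by simp [J]
  let D : Set (G → Bool) := cylinder J {y | y ⟨g⁻¹ * k, hkJ2⟩ = y ⟨k, hkJ⟩}
  have hD : ∀ x, x ∈ D ↔ x (g⁻¹ * k) = x k := fun x => Iff.rfl
  have hTJ : Disjoint T J := by
    rw [Finset.disjoint_left]
    intro a ha haJ
    simp only [J, Finset.mem_insert, Finset.mem_singleton] at haJ
    rcases haJ with rfl | rfl
    · exact hk.1 ha
    · exact hk2 ha
  have hind : μ.real (cylinder T B ∩ D) = μ.real (cylinder T B) * μ.real D :=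
    bern_indep hp hμ T J hTJ B _
  have hDle : μ.real D ≤ 1 - p * (1 - p) := by
    let Q : Set (G → Bool) := {x | ∀ h ∈ J, x h = (fun j => decide (j = k)) h}
    have hQ : μ.real Q = p * (1 - p) := by
      rw [measureReal_def, hμ.2 J (fun j => decide (j = k))]
      simp only [J]
      rw [Finset.prod_pair hkne.symm]
      simp only [hkne, decide_true, decide_false]
      rw [ENNReal.toReal_mul]
      simp [ENNReal.toReal_ofReal, hp.1.le, hp.2.le, mul_comm]
    have hQm : MeasurableSet Q := by
      have : Q = Set.pi J (fun h => {decide (h = k)}) := by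
        ext x; simp [Q, Set.mem_pi]
      rw [this]
      exact MeasurableSet.pi J.countable_toSet fun _ _ => measurableSet_singleton _
    have hdisj : Disjoint D Q := by
      rw [Set.disjoint_left]
      intro x hx hxQ
      rw [hD, hxQ _ hkJ, hxQ _ hkJ2] at hx
      simp [hg] at hx
    have h1 := measureReal_union (μ := μ) hdisj hQm
    have h2 : μ.real (D ∪ Q) ≤ 1 := measureReal_le_one
    linarith
  have hED : μ.real E ≤ μ.real (cylinder T B ∩ D) + μ.real (E ∆ cylinder T B) := by
    refine (measureReal_mono (s₂ := (cylinder T B ∩ D) ∪ E ∆ cylinder T B) ?_).trans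
      (measureReal_union_le _ _)
    intro x hx
    by_cases h : x ∈ cylinder T B
    · exact Or.inl ⟨h, (hD x).2 (congrFun hx k)⟩
    · exact Or.inr (Or.inl ⟨hx, h⟩)
  have hCE : μ.real (cylinder T B) ≤ μ.real E + μ.real (E ∆ cylinder T B) := by
    rw [symmDiff_comm]; exact real_le_add_symmDiff μ _ _
  have hC0 : 0 ≤ μ.real (cylinder T B) := measureReal_nonneg
  have hb : 0 ≤ μ.real (E ∆ cylinder T B) := measureReal_nonneg
  have hD0 : 0 ≤ μ.real D := measureReal_nonneg
  have h1 : μ.real (cylinder T B) * μ.real D ≤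
      (μ.real E + μ.real (E ∆ cylinder T B)) * (1 - p * (1 - p)) :=
    mul_le_mul hCE hDle hD0 (by linarith)
  nlinarith [mul_nonneg hq.le hb, mul_pos hq hpos]

lemma bern_free_ae [Infinite G] [Countable G] {p : ℝ} (hp : p ∈ Set.Ioo (0 : ℝ) 1)
    {μ : Measure (G → Bool)} (hμ : IsBernoulli p μ) : ∀ᵐ x ∂μ, x ∈ FreePart G := by
  have : ∀ᵐ x ∂μ, ∀ g : G, g ≠ 1 → shiftMap g x ≠ x := by
    rw [ae_all_iff]
    intro g
    by_cases hg : g = 1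
    · simp [hg]
    · have := bern_fixed_null hp hμ hg
      rw [ae_iff]
      simpa [hg] using this
  exact this

lemma shift_cylinder (h : G) (T : Finset G) (B : Set (T → Bool)) [DecidableEq G] :
    ∃ B' : Set ((T.image (fun k => h⁻¹ * k) : Finset G) → Bool),
      shiftMap h ⁻¹' cylinder T B = cylinder (T.image (fun k => h⁻¹ * k)) B' := by
  refine ⟨{y | (fun i : T => y ⟨h⁻¹ * i, Finset.mem_image_of_mem _ i.2⟩) ∈ B}, ?_⟩
  rfl

theorem no_meas [Infinite G] {S : Set G} (hS : IsMarkedGroup S) {p : ℝ}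
    (hp : p ∈ Set.Ioo (0 : ℝ) 1) {μ : Measure (G → Bool)} (hμ : IsBernoulli p μ)
    (c : (G → Bool) → Fin 2) (hm : NullMeasurable c μ)
    (hc : ∀ x y : FreePart G, ShiftAdj S x y → c (x : G → Bool) ≠ c (y : G → Bool)) : False := by
  classical
  have : Countable G := markedGroup_countable hS
  have := hμ.1
  have hfree := bern_free_ae hp hμ
  obtain ⟨s, hs⟩ := markedGroup_nonempty hS
  obtain ⟨A, -, hAm, hA⟩ :=
    (hm (measurableSet_singleton (0 : Fin 2))).exists_measurable_superset_ae_eq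
  have hA' : ∀ᵐ x ∂μ, (x ∈ A ↔ c x = 0) := Filter.eventuallyEq_set.1 hA
  have hsh : ∀ g : G, ∀ᵐ x ∂μ, (shiftMap g x ∈ A ↔ c (shiftMap g x) = 0) := fun g =>
    (bern_invariant hμ g).quasiMeasurePreserving.ae hA'
  have hhalf : μ.real A = 1 / 2 := by
    have h1 : shiftMap s ⁻¹' A =ᵐ[μ] (Aᶜ : Set (G → Bool)) := by
      refine Filter.eventuallyEq_set.2 ?_
      filter_upwards [hfree, hA', hsh s] with x hx h1 h2
      have := hc ⟨x, hx⟩ _ (fshift_adj hS hs ⟨x, hx⟩)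
      simp only [fshift] at this
      rw [Set.mem_preimage, Set.mem_compl_iff, h1, h2]
      omega
    have h2 : μ.real (shiftMap s ⁻¹' A) = μ.real A := by
      rw [measureReal_def, (bern_invariant hμ s).measure_preimage hAm.nullMeasurableSet,
        measureReal_def]
    have h3 : μ.real (shiftMap s ⁻¹' A) = μ.real Aᶜ := measureReal_congr h1
    rw [probReal_compl_eq_one_sub hAm] at h3
    linarith
  obtain ⟨T, B, hTB⟩ := bern_approx μ hAm (ε := 1 / 100) (by norm_num)
  obtain ⟨h, hH, hav⟩ := exists_avoid (even_infinite hS (fun x => c x.1) hc) T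
  obtain ⟨B', hB'⟩ := shift_cylinder h T B
  have hCm : MeasurableSet (cylinder T B) :=
    (Finset.measurable_restrict (X := fun _ : G => Bool) T) (Set.toFinite B).measurableSet
  have hinv : shiftMap h ⁻¹' A =ᵐ[μ] A := by
    refine Filter.eventuallyEq_set.2 ?_
    filter_upwards [hfree, hA', hsh h] with x hx h1 h2
    have := hH ⟨x, hx⟩
    simp only [fshift] at this
    rw [Set.mem_preimage, h1, h2, this]
  have hTB' : μ.real (A ∆ (shiftMap h ⁻¹' cylinder T B)) < 1 / 100 := by
    have e1 : μ.real (A ∆ (shiftMap h ⁻¹' cylinder T B)) =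
        μ.real (shiftMap h ⁻¹' (A ∆ cylinder T B)) := by
      apply measureReal_congr
      rw [Set.preimage_symmDiff]
      exact hinv.symm.symmDiff (Filter.EventuallyEq.refl _ _)
    have e2 : μ.real (shiftMap h ⁻¹' (A ∆ cylinder T B)) = μ.real (A ∆ cylinder T B) := by
      rw [measureReal_def, (bern_invariant hμ h).measure_preimage
        (hAm.symmDiff hCm).nullMeasurableSet, measureReal_def]
    rw [e1, e2]; exact hTB
  have hdisj : Disjoint T (T.image (fun k => h⁻¹ * k)) := by
    rw [Finset.disjoint_left]
    intro a ha ha'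
    obtain ⟨b, hb, rfl⟩ := Finset.mem_image.1 ha'
    exact hav _ ha b hb (by group)
  have hind := bern_indep hp hμ T _ hdisj B B'
  rw [← hB'] at hind
  have hC' : μ.real (shiftMap h ⁻¹' cylinder T B) = μ.real (cylinder T B) := by
    rw [measureReal_def, (bern_invariant hμ h).measure_preimage hCm.nullMeasurableSet,
      measureReal_def]
  rw [hC'] at hind
  have hle : μ.real A ≤ μ.real (cylinder T B ∩ shiftMap h ⁻¹' cylinder T B) +
      (μ.real (A ∆ cylinder T B) + μ.real (A ∆ (shiftMap h ⁻¹' cylinder T B))) := by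
    refine le_trans ?_ (add_le_add le_rfl (measureReal_union_le _ _))
    refine le_trans ?_ (measureReal_union_le _ _)
    refine measureReal_mono ?_
    intro x hx
    by_cases h1 : x ∈ cylinder T B
    · by_cases h2 : x ∈ shiftMap h ⁻¹' cylinder T B
      · exact Or.inl ⟨h1, h2⟩
      · exact Or.inr (Or.inr (Or.inl ⟨hx, h2⟩))
    · exact Or.inr (Or.inl (Or.inl ⟨hx, h1⟩))
  have hCA : μ.real (cylinder T B) ≤ μ.real A + μ.real (A ∆ cylinder T B) := by
    rw [symmDiff_comm]; exact real_le_add_symmDiff μ _ _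
  have hC0 : 0 ≤ μ.real (cylinder T B) := measureReal_nonneg
  nlinarith

end Helpers

/-- Let `(G, S)` be an infinite marked group. Then (a) there is no
Baire measurable `2`-coloring of the shift graph of `(G, S)`, and (b) for every
`0 < p < 1`, the Bernoulli measure `μ_p` concentrates on `F(2^G)` and there is no
`μ_p`-measurable `2`-coloring of the shift graph. In particular the Baire measurable
and measure chromatic numbers of the shift graph are both greater than `2`. -/
theorem no_baire_or_measurable_two_coloring {G : Type*} [Group G] [Infinite G]
    (S : Set G) (hS : IsMarkedGroup S) :
    -- (a) no Baire measurable 2-coloring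
    (¬ ∃ c : FreePart G → Fin 2, (∀ i : Fin 2, BaireMeasurableSet (c ⁻¹' {i})) ∧
        ∀ x y, ShiftAdj S x y → c x ≠ c y) ∧
    -- (b) no μ_p-measurable 2-coloring
    (∀ p : ℝ, p ∈ Set.Ioo (0 : ℝ) 1 → ∀ μ : Measure (G → Bool), IsBernoulli p μ →
      μ (FreePart G) = 1 ∧
      ¬ ∃ c : (G → Bool) → Fin 2, NullMeasurable c μ ∧
          ∀ x y : FreePart G, ShiftAdj S x y →
            c (x : G → Bool) ≠ c (y : G → Bool)) := by
  refine ⟨fun ⟨c, hm, hc⟩ => no_baire hS c hm hc, fun p hp μ hμ => ⟨?_, ?_⟩⟩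
  · have : Countable G := markedGroup_countable hS
    have := hμ.1
    exact (mem_ae_iff_prob_eq_one isGδ_freePart.measurableSet).1 (bern_free_ae hp hμ)
  · rintro ⟨c, hm, hc⟩
    exact no_meas hS hp hμ c hm hc
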